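/- Fix Γ > 0, μ > 0 and δ ∈ [0, 4/5]. Let ω : ℝ³ → ℝ³ be continuous with compact support, and define u(x) = −(1/4π) ∫_{ℝ³} ∇φ_δ(x − y) × ω(y) dy. Then the rate-of-strain tensor S(x) = (∇u(x) + ∇u(x)ᵀ)/2 admits the representation S(x) = −(1/4π) ∫_{ℝ³} c(|x − y|) [ ((x − y) × ω(y)) ⊗ (x − y) + (x − y) ⊗ ((x − y) × ω(y)) ] dy, where c(r) = (1/4) Γ δ(2−δ) μ² r^{δ−4} A(r)^{−3/2} + (3/8) Γ B(r)² A(r)^{−5/2}, and the integral is absolutely convergent for each x. -/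

import Mathlib

open MeasureTheory Real

noncomputable section

abbrev E3 := EuclideanSpace ℝ (Fin 3)

/-- The cross product on `ℝ³`. -/
noncomputable def cross3 (a b : E3) : E3 :=
  (EuclideanSpace.equiv (Fin 3) ℝ).symm
    ![a 1 * b 2 - a 2 * b 1, a 2 * b 0 - a 0 * b 2, a 0 * b 1 - a 1 * b 0]

/-- The pointwise gradient of `φ_δ`:
`∇φ_δ(z) = −(Γ/2) (2 + δ μ² |z|^{δ−2}) (|z|² + μ² |z|^δ)^{−3/2} z`. -/
noncomputable def gradPhi (Γ μ δ : ℝ) (z : E3) : E3 :=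
  (-(Γ / 2) * (2 + δ * μ ^ 2 * ‖z‖ ^ (δ - 2)) *
    (‖z‖ ^ 2 + μ ^ 2 * ‖z‖ ^ δ) ^ (-(3 : ℝ) / 2)) • z

/-- `A(r) = r² + μ² r^δ`. -/
noncomputable def Afun (μ δ r : ℝ) : ℝ := r ^ 2 + μ ^ 2 * r ^ δ

/-- `B(r) = 2 + δ μ² r^{δ−2}`. -/
noncomputable def Bfun (μ δ r : ℝ) : ℝ := 2 + δ * μ ^ 2 * r ^ (δ - 2)

/-- The kernel `c(r) = (1/4) Γ δ(2−δ) μ² r^{δ−4} A(r)^{−3/2} + (3/8) Γ B(r)² A(r)^{−5/2}`. -/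
noncomputable def cKer (Γ μ δ r : ℝ) : ℝ :=
  1 / 4 * Γ * δ * (2 - δ) * μ ^ 2 * r ^ (δ - 4) * Afun μ δ r ^ (-(3 : ℝ) / 2) +
  3 / 8 * Γ * Bfun μ δ r ^ 2 * Afun μ δ r ^ (-(5 : ℝ) / 2)

/-- The velocity field given by the approximate Biot–Savart law
`u(x) = −(1/4π) ∫ ∇φ_δ(x − y) × ω(y) dy`. -/
noncomputable def biotSavart (Γ μ δ : ℝ) (ω : E3 → E3) (x : E3) : E3 :=
  (-(1 / (4 * π))) • ∫ y : E3, cross3 (gradPhi Γ μ δ (x - y)) (ω y)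

/-- The standard basis vector `eᵢ` of `ℝ³`. -/
noncomputable def e3 (i : Fin 3) : E3 := EuclideanSpace.single i (1 : ℝ)

open Set Convolution in
/-- A compactly supported continuous function convolved with a kernel which is differentiable away
from the origin is differentiable, provided the kernel and its derivative are locally integrable and
the dimension is at least two. -/
theorem hasFDerivAt_convolution_of_differentiable_off_zero {G F F' F'' : Type*}
    [NormedAddCommGroup G] [NormedSpace ℝ G] [FiniteDimensional ℝ G]
    [MeasurableSpace G] [BorelSpace G]
    [NormedAddCommGroup F] [NormedSpace ℝ F] [NormedAddCommGroup F'] [NormedSpace ℝ F']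
    [NormedAddCommGroup F''] [NormedSpace ℝ F''] [CompleteSpace F'']
    (μ : Measure G) [μ.IsAddHaarMeasure] (hdim : 1 < Module.finrank ℝ G)
    (L : F →L[ℝ] F' →L[ℝ] F'') {f : G → F} {K : G → F'} {K' : G → G →L[ℝ] F'}
    (hf : Continuous f) (hcf : HasCompactSupport f)
    (hK : LocallyIntegrable K μ) (hK' : LocallyIntegrable K' μ)
    (hd : ∀ z, z ≠ 0 → HasFDerivAt K (K' z) z) (hc : ContinuousOn K' {0}ᶜ) (x : G) :
    HasFDerivAt (f ⋆[L, μ] K) ((f ⋆[L.precompR G, μ] K') x) x := by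
  have hcont : Continuous (f ⋆[L.precompR G, μ] K') :=
    hcf.continuous_convolution_left _ hf hK'
  have hKn : LocallyIntegrable (fun z => ‖K' z‖) μ :=
    hK'.mono hK'.aestronglyMeasurable.norm (by simp)
  have hcontn : Continuous ((fun y => ‖f y‖) ⋆[ContinuousLinearMap.mul ℝ ℝ, μ] fun z => ‖K' z‖) :=
    hcf.norm.continuous_convolution_left _ hf.norm hKn
  have hexn := hcf.norm.convolutionExists_left (ContinuousLinearMap.mul ℝ ℝ) hf.norm hKn
  have hex := hcf.convolutionExists_left (L.precompR G) hf hK'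
  have hexK := hcf.convolutionExists_left L hf hK
  have hmeas (v : G) : AEStronglyMeasurable (fun p : ℝ × G => K' (x + p.1 • v - p.2))
      ((volume.restrict (Set.uIoc (0 : ℝ) 1)).prod μ) := by
    refine hK'.aestronglyMeasurable.comp_quasiMeasurePreserving
      (f := fun p : ℝ × G => x + p.1 • v - p.2) ?_
    refine QuasiMeasurePreserving.prod_of_right (by fun_prop) (ae_of_all _ fun t => ?_)
    exact quasiMeasurePreserving_sub_left μ (x + t • v)
  have hD (v : G) : Integrable (fun p : ℝ × G => ‖f p.2‖ * ‖K' (x + p.1 • v - p.2)‖)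
      ((volume.restrict (Set.uIoc (0 : ℝ) 1)).prod μ) := by
    rw [integrable_prod_iff]
    · refine ⟨ae_of_all _ fun t => hexn (x + t • v), ?_⟩
      have : Continuous fun t : ℝ =>
          ((fun y => ‖f y‖) ⋆[ContinuousLinearMap.mul ℝ ℝ, μ] fun z => ‖K' z‖) (x + t • v) :=
        hcontn.comp (by fun_prop)
      have h2 := (this.intervalIntegrable (μ := volume) 0 1)
      rw [intervalIntegrable_iff] at h2
      refine h2.congr (ae_of_all _ fun t => ?_)
      simp [convolution]
    · exact (hf.norm.comp continuous_snd).aestronglyMeasurable.mul (hmeas v).norm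
  have hP (v : G) : Integrable (Function.uncurry fun (t : ℝ) (y : G) =>
      L (f y) (K' (x + t • v - y) v)) ((volume.restrict (Set.uIoc (0 : ℝ) 1)).prod μ) := by
    refine ((hD v).mul_const (‖L‖ * ‖v‖)).mono' ?_ (ae_of_all _ fun p => ?_)
    · have h1 : AEStronglyMeasurable (fun p : ℝ × G => K' (x + p.1 • v - p.2) v)
          ((volume.restrict (Set.uIoc (0 : ℝ) 1)).prod μ) :=
        (ContinuousLinearMap.apply ℝ F' v).continuous.comp_aestronglyMeasurable (hmeas v)
      exact L.aestronglyMeasurable_comp₂ (hf.comp continuous_snd).aestronglyMeasurable h1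
    · calc ‖L (f p.2) (K' (x + p.1 • v - p.2) v)‖
          ≤ ‖L‖ * ‖f p.2‖ * ‖K' (x + p.1 • v - p.2) v‖ := L.le_opNorm₂ _ _
        _ ≤ ‖L‖ * ‖f p.2‖ * (‖K' (x + p.1 • v - p.2)‖ * ‖v‖) := by
            gcongr; exact ContinuousLinearMap.le_opNorm _ _
        _ = _ := by ring
  have key (v : G) : (f ⋆[L, μ] K) (x + v) - (f ⋆[L, μ] K) x =
      ∫ t in (0 : ℝ)..1, (f ⋆[L.precompR G, μ] K') (x + t • v) v := by
    have hline : ∀ᵐ y ∂μ, x - y ∉ Submodule.span ℝ {v} := by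
      have h0 : μ (Submodule.span ℝ {v} : Submodule ℝ G) = 0 := by
        refine Measure.addHaar_submodule μ _ fun h => ?_
        have h1 := finrank_span_le_card (R := ℝ) ({v} : Set G)
        rw [h, finrank_top] at h1
        simp at h1
        omega
      exact (quasiMeasurePreserving_sub_left μ x).ae (measure_eq_zero_iff_ae_notMem.1 h0)
    have hftc : ∀ᵐ y ∂μ, L (f y) (K (x + v - y)) - L (f y) (K (x - y)) =
        ∫ t in (0 : ℝ)..1, L (f y) (K' (x + t • v - y) v) := by
      filter_upwards [hline] with y hy
      have hne (t : ℝ) : x + t • v - y ≠ 0 := fun h => hy <| by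
        rw [show x - y = (-t) • v by rw [neg_smul, eq_neg_iff_add_eq_zero, ← h]; abel]
        exact Submodule.smul_mem _ _ (Submodule.mem_span_singleton_self v)
      have hlin (t : ℝ) : HasDerivAt (fun t : ℝ => x + t • v - y) v t := by
        simpa using (((hasDerivAt_id t).smul_const v).const_add x).sub_const y
      have hder (t : ℝ) : HasDerivAt (fun t : ℝ => L (f y) (K (x + t • v - y)))
          (L (f y) (K' (x + t • v - y) v)) t :=
        (L (f y)).hasFDerivAt.comp_hasDerivAt t ((hd _ (hne t)).comp_hasDerivAt t (hlin t))
      have hcd : Continuous fun t : ℝ => L (f y) (K' (x + t • v - y) v) := by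
        have : Continuous fun t : ℝ => K' (x + t • v - y) :=
          hc.comp_continuous (by fun_prop) hne
        exact (L (f y)).continuous.comp (this.clm_apply continuous_const)
      rw [intervalIntegral.integral_eq_sub_of_hasDerivAt (fun t _ => hder t)
        (hcd.intervalIntegrable 0 1)]
      simp
    calc (f ⋆[L, μ] K) (x + v) - (f ⋆[L, μ] K) x
        = ∫ y, (L (f y) (K (x + v - y)) - L (f y) (K (x - y))) ∂μ :=
          (integral_sub (hexK (x + v)) (hexK x)).symm
      _ = ∫ y, (∫ t in (0 : ℝ)..1, L (f y) (K' (x + t • v - y) v)) ∂μ := integral_congr_ae hftc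
      _ = ∫ t in (0 : ℝ)..1, ∫ y, L (f y) (K' (x + t • v - y) v) ∂μ :=
          (intervalIntegral_integral_swap (hP v)).symm
      _ = _ := by
          congr 1
          ext t
          exact (ContinuousLinearMap.integral_apply (hex (x + t • v)) v).symm
  rw [hasFDerivAt_iff_isLittleO_nhds_zero, Asymptotics.isLittleO_iff]
  intro ε hε
  obtain ⟨ρ, hρ, hball⟩ := Metric.continuousAt_iff.1 hcont.continuousAt ε hε
  filter_upwards [Metric.ball_mem_nhds (0 : G) hρ] with v hv
  rw [mem_ball_zero_iff] at hv
  have hci : Continuous fun t : ℝ => (f ⋆[L.precompR G, μ] K') (x + t • v) v := by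
    have : Continuous fun t : ℝ => (f ⋆[L.precompR G, μ] K') (x + t • v) :=
      hcont.comp (by fun_prop)
    fun_prop
  have hsub : (∫ t in (0 : ℝ)..1, (f ⋆[L.precompR G, μ] K') (x + t • v) v) -
      (f ⋆[L.precompR G, μ] K') x v = ∫ t in (0 : ℝ)..1,
        ((f ⋆[L.precompR G, μ] K') (x + t • v) v - (f ⋆[L.precompR G, μ] K') x v) := by
    rw [intervalIntegral.integral_sub (hci.intervalIntegrable 0 1) (by simp)]
    simp
  rw [key, hsub]
  refine (intervalIntegral.norm_integral_le_of_norm_le_const (C := ε * ‖v‖) fun t ht => ?_).trans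
    (by simp)
  rw [uIoc_of_le zero_le_one] at ht
  rw [← sub_apply]
  refine (ContinuousLinearMap.le_opNorm _ _).trans ?_
  gcongr
  rw [← dist_eq_norm]
  refine (hball ?_).le
  rw [dist_eq_norm, add_sub_cancel_left, norm_smul, Real.norm_of_nonneg ht.1.le]
  exact (mul_le_of_le_one_left (norm_nonneg _) ht.2).trans_lt hv

section Kernel

variable {Γ μ δ : ℝ}

/-- The radial profile of `gradPhi`. -/
def gradProfile (Γ μ δ r : ℝ) : ℝ := -(Γ / 2) * Bfun μ δ r * Afun μ δ r ^ (-(3 : ℝ) / 2)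

/-- The derivative of `gradPhi` away from the origin. -/
def gradPhiDeriv (Γ μ δ : ℝ) (z : E3) : E3 →L[ℝ] E3 :=
  gradProfile Γ μ δ ‖z‖ • ContinuousLinearMap.id ℝ E3 +
    (2 * cKer Γ μ δ ‖z‖) • (innerSL ℝ z).smulRight z

theorem gradPhi_eq (z : E3) : gradPhi Γ μ δ z = gradProfile Γ μ δ ‖z‖ • z := rfl

theorem Afun_pos (hμ : 0 < μ) {r : ℝ} (hr : 0 < r) : 0 < Afun μ δ r := by
  unfold Afun; positivity

theorem hasDerivAt_Afun {r : ℝ} (hr : 0 < r) :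
    HasDerivAt (Afun μ δ) (r * Bfun μ δ r) r := by
  have h := ((hasDerivAt_id r).pow 2).add
    ((Real.hasDerivAt_rpow_const (p := δ) (Or.inl hr.ne')).const_mul (μ ^ 2))
  refine h.congr_deriv ?_
  have : r ^ (δ - 1) = r * r ^ (δ - 2) := by
    rw [mul_comm, ← Real.rpow_add_one hr.ne']
    ring_nf
  simp only [Bfun, this, id]
  norm_num
  ring

theorem hasDerivAt_Bfun {r : ℝ} (hr : 0 < r) :
    HasDerivAt (Bfun μ δ) (δ * (δ - 2) * μ ^ 2 * (r * r ^ (δ - 4))) r := by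
  have h := ((Real.hasDerivAt_rpow_const (p := δ - 2) (Or.inl hr.ne')).const_mul
    (δ * μ ^ 2)).const_add 2
  refine h.congr_deriv ?_
  have : r ^ (δ - 2 - 1) = r * r ^ (δ - 4) := by
    rw [mul_comm, ← Real.rpow_add_one hr.ne']
    ring_nf
  rw [this]
  ring

theorem hasDerivAt_gradProfile (hμ : 0 < μ) {r : ℝ} (hr : 0 < r) :
    HasDerivAt (gradProfile Γ μ δ) (2 * r * cKer Γ μ δ r) r := by
  have h := ((hasDerivAt_Bfun (μ := μ) (δ := δ) hr).const_mul (-(Γ / 2))).mul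
    ((hasDerivAt_Afun (μ := μ) (δ := δ) hr).rpow_const (p := -(3 : ℝ) / 2)
      (Or.inl (Afun_pos hμ hr).ne'))
  refine h.congr_deriv ?_
  rw [show (-(3 : ℝ) / 2 - 1) = -(5 : ℝ) / 2 by norm_num]
  unfold cKer
  ring

theorem hasFDerivAt_gradPhi (hμ : 0 < μ) {z : E3} (hz : z ≠ 0) :
    HasFDerivAt (gradPhi Γ μ δ) (gradPhiDeriv Γ μ δ z) z := by
  have hr : 0 < ‖z‖ := norm_pos_iff.2 hz
  have hn : HasFDerivAt (fun z : E3 => ‖z‖) (‖z‖⁻¹ • innerSL ℝ z) z := by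
    have h := (hasStrictFDerivAt_norm_sq z).hasFDerivAt.sqrt (by positivity)
    simp only [Real.sqrt_sq (norm_nonneg _)] at h
    refine h.congr_fderiv ?_
    ext w
    simp
    field_simp
  have h := ((hasDerivAt_gradProfile (Γ := Γ) (δ := δ) hμ hr).comp_hasFDerivAt z hn).smul
    (hasFDerivAt_id z)
  refine h.congr_fderiv ?_
  ext w : 1
  simp only [gradPhiDeriv, add_apply, smul_apply,
    ContinuousLinearMap.smulRight_apply, Function.comp_apply, id, smul_smul, smul_eq_mul]
  congr 2
  field_simp

theorem continuousOn_Afun : ContinuousOn (Afun μ δ) (Set.Ioi 0) := fun _ hr =>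
  (hasDerivAt_Afun hr).continuousAt.continuousWithinAt

theorem continuousOn_Bfun : ContinuousOn (Bfun μ δ) (Set.Ioi 0) := fun _ hr =>
  (hasDerivAt_Bfun hr).continuousAt.continuousWithinAt

theorem continuousOn_gradProfile (hμ : 0 < μ) :
    ContinuousOn (gradProfile Γ μ δ) (Set.Ioi 0) := fun _ hr =>
  (hasDerivAt_gradProfile hμ hr).continuousAt.continuousWithinAt

theorem continuousOn_cKer (hμ : 0 < μ) : ContinuousOn (cKer Γ μ δ) (Set.Ioi 0) := by
  have hA (p : ℝ) : ContinuousOn (fun r => Afun μ δ r ^ p) (Set.Ioi 0) :=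
    continuousOn_Afun.rpow_const fun r hr => Or.inl (Afun_pos hμ hr).ne'
  have hp : ContinuousOn (fun r : ℝ => r ^ (δ - 4)) (Set.Ioi 0) :=
    continuousOn_id.rpow_const fun r hr => Or.inl (ne_of_gt hr)
  exact ((hp.const_smul (1 / 4 * Γ * δ * (2 - δ) * μ ^ 2)).mul (hA _)).add
    (((continuousOn_Bfun.pow 2).const_smul (3 / 8 * Γ)).mul (hA _))

theorem mapsTo_norm_compl_zero : Set.MapsTo (fun z : E3 => ‖z‖) {0}ᶜ (Set.Ioi 0) :=
  fun _ hz => norm_pos_iff.2 hz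

theorem continuousOn_gradPhi (hμ : 0 < μ) : ContinuousOn (gradPhi Γ μ δ) {0}ᶜ := fun _ hz =>
  (hasFDerivAt_gradPhi hμ hz).continuousAt.continuousWithinAt

theorem continuousOn_gradPhiDeriv (hμ : 0 < μ) : ContinuousOn (gradPhiDeriv Γ μ δ) {0}ᶜ := by
  have h1 := (continuousOn_gradProfile (Γ := Γ) (δ := δ) hμ).comp continuous_norm.continuousOn
    mapsTo_norm_compl_zero
  have h2 := (continuousOn_cKer (Γ := Γ) (δ := δ) hμ).comp continuous_norm.continuousOn
    mapsTo_norm_compl_zero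
  have h3 : Continuous fun z : E3 => (innerSL ℝ z).smulRight z := by fun_prop
  exact (h1.smul continuousOn_const).add ((h2.const_smul (2 : ℝ)).smul h3.continuousOn)

theorem Bfun_le (hδ0 : 0 ≤ δ) (hδ2 : δ ≤ 2) {r : ℝ} (hr : 0 < r) :
    0 ≤ Bfun μ δ r ∧ Bfun μ δ r ≤ 2 * Afun μ δ r / r ^ 2 := by
  refine ⟨by unfold Bfun; positivity, ?_⟩
  have h : r ^ (δ - 2) = r ^ δ / r ^ 2 := by
    rw [Real.rpow_sub hr, Real.rpow_two]
  have : Bfun μ δ r = (2 * r ^ 2 + δ * (μ ^ 2 * r ^ δ)) / r ^ 2 := by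
    unfold Bfun
    rw [h]
    field_simp
  rw [this]
  unfold Afun
  gcongr
  have : 0 ≤ μ ^ 2 * r ^ δ := by positivity
  nlinarith

theorem Afun_rpow_neg_half_le (hμ : 0 < μ) {r : ℝ} (hr : 0 < r) :
    Afun μ δ r ^ (-(1 : ℝ) / 2) ≤ μ⁻¹ * r ^ (-(δ / 2)) := by
  have h : μ ^ 2 * r ^ δ ≤ Afun μ δ r := by unfold Afun; nlinarith [sq_nonneg r]
  calc Afun μ δ r ^ (-(1 : ℝ) / 2) ≤ (μ ^ 2 * r ^ δ) ^ (-(1 : ℝ) / 2) :=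
        Real.rpow_le_rpow_of_nonpos (by positivity) h (by norm_num)
    _ = μ⁻¹ * r ^ (-(δ / 2)) := by
        rw [Real.mul_rpow (by positivity) (by positivity), ← Real.rpow_mul hr.le,
          ← Real.rpow_natCast, ← Real.rpow_mul hμ.le, ← Real.rpow_neg_one]
        congr 2 <;> push_cast <;> ring

theorem Afun_rpow_sub_nat (hμ : 0 < μ) {r : ℝ} (hr : 0 < r) :
    Afun μ δ r ^ (-(3 : ℝ) / 2) = Afun μ δ r ^ (-(1 : ℝ) / 2) / Afun μ δ r ∧
    Afun μ δ r ^ (-(5 : ℝ) / 2) = Afun μ δ r ^ (-(1 : ℝ) / 2) / Afun μ δ r ^ 2 := by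
  have hA := Afun_pos (δ := δ) hμ hr
  constructor
  · rw [← Real.rpow_sub_one hA.ne']; norm_num
  · rw [← Real.rpow_two, ← Real.rpow_sub hA]; norm_num

theorem abs_gradProfile_le (hΓ : 0 < Γ) (hμ : 0 < μ) (hδ0 : 0 ≤ δ) (hδ2 : δ ≤ 2) {r : ℝ}
    (hr : 0 < r) : |gradProfile Γ μ δ r| ≤ Γ * (Afun μ δ r ^ (-(1 : ℝ) / 2) / r ^ 2) := by
  have hA := Afun_pos (δ := δ) hμ hr
  obtain ⟨hB0, hB⟩ := Bfun_le (μ := μ) hδ0 hδ2 hr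
  have : |gradProfile Γ μ δ r| = Γ / 2 * Bfun μ δ r * Afun μ δ r ^ (-(3 : ℝ) / 2) := by
    rw [gradProfile, neg_mul, neg_mul, abs_neg, abs_of_nonneg (by positivity)]
  rw [this, (Afun_rpow_sub_nat hμ hr).1]
  calc _ ≤ Γ / 2 * (2 * Afun μ δ r / r ^ 2) * (Afun μ δ r ^ (-(1 : ℝ) / 2) / Afun μ δ r) := by
        gcongr
    _ = _ := by field_simp

theorem abs_cKer_le (hΓ : 0 < Γ) (hμ : 0 < μ) (hδ0 : 0 ≤ δ) (hδ2 : δ ≤ 2) {r : ℝ}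
    (hr : 0 < r) : |cKer Γ μ δ r| ≤ 2 * Γ * (Afun μ δ r ^ (-(1 : ℝ) / 2) / r ^ 4) := by
  have hA := Afun_pos (δ := δ) hμ hr
  obtain ⟨hB0, hB⟩ := Bfun_le (μ := μ) hδ0 hδ2 hr
  have h2δ : 0 ≤ 2 - δ := by linarith
  have hpow : r ^ (δ - 4) = r ^ δ / r ^ 4 := by
    rw [Real.rpow_sub hr, ← Real.rpow_natCast]; norm_num
  have h1 : δ * (2 - δ) * (μ ^ 2 * r ^ δ) ≤ Afun μ δ r := by
    have : 0 ≤ μ ^ 2 * r ^ δ := by positivity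
    unfold Afun
    nlinarith [sq_nonneg r, mul_nonneg (sq_nonneg (δ - 1)) this]
  have hc0 : 0 ≤ cKer Γ μ δ r := by unfold cKer; positivity
  have h3 : Bfun μ δ r ^ 2 ≤ (2 * Afun μ δ r / r ^ 2) ^ 2 := by gcongr
  rw [abs_of_nonneg hc0, cKer, (Afun_rpow_sub_nat hμ hr).1, (Afun_rpow_sub_nat hμ hr).2, hpow]
  set a := Afun μ δ r ^ (-(1 : ℝ) / 2)
  have ha : 0 ≤ a := by positivity
  calc _ = Γ / 4 * ((δ * (2 - δ) * (μ ^ 2 * r ^ δ)) / r ^ 4) * (a / Afun μ δ r) +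
        3 / 8 * Γ * Bfun μ δ r ^ 2 * (a / Afun μ δ r ^ 2) := by ring
    _ ≤ Γ / 4 * (Afun μ δ r / r ^ 4) * (a / Afun μ δ r) +
        3 / 8 * Γ * (2 * Afun μ δ r / r ^ 2) ^ 2 * (a / Afun μ δ r ^ 2) := by gcongr
    _ = (7 / 4 * Γ) * (a / r ^ 4) := by field_simp; ring
    _ ≤ _ := by gcongr; norm_num

theorem Afun_rpow_neg_half_div_sq_le (hμ : 0 < μ) {r : ℝ} (hr : 0 < r) :
    Afun μ δ r ^ (-(1 : ℝ) / 2) / r ^ 2 ≤ μ⁻¹ * r ^ (-(2 + δ / 2)) := by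
  have : r ^ (-(2 + δ / 2)) = r ^ (-(δ / 2)) / r ^ 2 := by
    rw [← Real.rpow_two, ← Real.rpow_sub hr]; ring_nf
  rw [this, ← mul_div_assoc]
  gcongr
  exact Afun_rpow_neg_half_le hμ hr

theorem norm_gradPhi_le (hΓ : 0 < Γ) (hμ : 0 < μ) (hδ0 : 0 ≤ δ) (hδ2 : δ ≤ 2) {z : E3}
    (hz : z ≠ 0) : ‖gradPhi Γ μ δ z‖ ≤ Γ * μ⁻¹ * ‖z‖ ^ (-(1 + δ / 2)) := by
  have hr : 0 < ‖z‖ := norm_pos_iff.2 hz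
  have : ‖z‖ ^ (-(1 + δ / 2)) = ‖z‖ ^ (-(2 + δ / 2)) * ‖z‖ := by
    rw [← Real.rpow_add_one hr.ne']; ring_nf
  rw [gradPhi_eq, norm_smul, this, ← mul_assoc, mul_assoc Γ]
  gcongr
  exact (abs_gradProfile_le hΓ hμ hδ0 hδ2 hr).trans
    (by gcongr; exact Afun_rpow_neg_half_div_sq_le hμ hr)

theorem norm_gradPhiDeriv_le (hΓ : 0 < Γ) (hμ : 0 < μ) (hδ0 : 0 ≤ δ) (hδ2 : δ ≤ 2) {z : E3}
    (hz : z ≠ 0) : ‖gradPhiDeriv Γ μ δ z‖ ≤ 5 * Γ * μ⁻¹ * ‖z‖ ^ (-(2 + δ / 2)) := by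
  have hr : 0 < ‖z‖ := norm_pos_iff.2 hz
  have h1 := abs_gradProfile_le hΓ hμ hδ0 hδ2 hr
  have h2 := abs_cKer_le hΓ hμ hδ0 hδ2 hr
  set a := Afun μ δ ‖z‖ ^ (-(1 : ℝ) / 2)
  calc ‖gradPhiDeriv Γ μ δ z‖
      ≤ |gradProfile Γ μ δ ‖z‖| * 1 + (2 * |cKer Γ μ δ ‖z‖|) * (‖z‖ * ‖z‖) := by
        refine (norm_add_le _ _).trans ?_
        rw [norm_smul, norm_smul, ContinuousLinearMap.norm_smulRight_apply, innerSL_apply_norm,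
          norm_mul, Real.norm_eq_abs, Real.norm_eq_abs, Real.norm_eq_abs, abs_two]
        gcongr
        exact ContinuousLinearMap.norm_id_le
    _ ≤ Γ * (a / ‖z‖ ^ 2) * 1 + (2 * (2 * Γ * (a / ‖z‖ ^ 4))) * (‖z‖ * ‖z‖) := by gcongr
    _ = 5 * Γ * (a / ‖z‖ ^ 2) := by field_simp; ring
    _ ≤ 5 * Γ * (μ⁻¹ * ‖z‖ ^ (-(2 + δ / 2))) := by
        gcongr; exact Afun_rpow_neg_half_div_sq_le hμ hr
    _ = _ := by ring

theorem ae_ne_zero : ∀ᵐ z : E3, z ≠ 0 := by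
  simp [ae_iff]

theorem aestronglyMeasurable_of_continuousOn_compl_zero {F : Type*} [NormedAddCommGroup F]
    {f : E3 → F} (hf : ContinuousOn f {0}ᶜ) : AEStronglyMeasurable f volume := by
  rw [← restrict_compl_singleton (μ := (volume : Measure E3)) (0 : E3)]
  exact hf.aestronglyMeasurable (measurableSet_singleton 0).compl

theorem locallyIntegrable_gradPhi (hΓ : 0 < Γ) (hμ : 0 < μ) (hδ0 : 0 ≤ δ) (hδ2 : δ < 2) :
    LocallyIntegrable (gradPhi Γ μ δ) volume := by
  refine locallyIntegrable_of_norm_le_rpow (by simp) (C := Γ * μ⁻¹) (α := 1 + δ / 2)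
    (by rw [finrank_euclideanSpace_fin]; push_cast; linarith) ?_
    (aestronglyMeasurable_of_continuousOn_compl_zero (continuousOn_gradPhi hμ))
  filter_upwards [ae_ne_zero] with z hz using norm_gradPhi_le hΓ hμ hδ0 hδ2.le hz

theorem locallyIntegrable_gradPhiDeriv (hΓ : 0 < Γ) (hμ : 0 < μ) (hδ0 : 0 ≤ δ) (hδ2 : δ < 2) :
    LocallyIntegrable (gradPhiDeriv Γ μ δ) volume := by
  refine locallyIntegrable_of_norm_le_rpow (by simp) (C := 5 * Γ * μ⁻¹) (α := 2 + δ / 2)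
    (by rw [finrank_euclideanSpace_fin]; push_cast; linarith) ?_
    (aestronglyMeasurable_of_continuousOn_compl_zero (continuousOn_gradPhiDeriv hμ))
  filter_upwards [ae_ne_zero] with z hz using norm_gradPhiDeriv_le hΓ hμ hδ0 hδ2.le hz

end Kernel

/-- The cross product as a bilinear map, with its arguments exchanged. -/
def crossFlipL : E3 →L[ℝ] E3 →L[ℝ] E3 :=
  (LinearMap.mk₂ ℝ (fun w z => cross3 z w)
    (fun a b c => by ext i; fin_cases i <;> simp [cross3] <;> ring)
    (fun t a b => by ext i; fin_cases i <;> simp [cross3] <;> ring)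
    (fun a b c => by ext i; fin_cases i <;> simp [cross3] <;> ring)
    (fun t a b => by ext i; fin_cases i <;> simp [cross3] <;> ring)).toContinuousBilinearMap

theorem crossFlipL_apply (w z : E3) : crossFlipL w z = cross3 z w := rfl

theorem cross3_e3_antisymm (w : E3) (i j : Fin 3) :
    cross3 (e3 i) w j + cross3 (e3 j) w i = 0 := by
  fin_cases i <;> fin_cases j <;> simp [cross3, e3]

theorem cross3_gradPhiDeriv_apply (Γ μ δ : ℝ) (z w : E3) (i j : Fin 3) :
    cross3 (gradPhiDeriv Γ μ δ z (e3 i)) w j =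
      gradProfile Γ μ δ ‖z‖ * cross3 (e3 i) w j + 2 * cKer Γ μ δ ‖z‖ * (z i * cross3 z w j) := by
  rw [← crossFlipL_apply w, ← crossFlipL_apply w, ← crossFlipL_apply w]
  simp [gradPhiDeriv, e3, EuclideanSpace.inner_single_right, mul_assoc]

theorem stmt9 (Γ μ δ : ℝ) (hΓ : 0 < Γ) (hμ : 0 < μ) (hδ : δ ∈ Set.Icc (0 : ℝ) (4 / 5))
    (ω : E3 → E3) (hω : Continuous ω) (hωsupp : HasCompactSupport ω) :
    ∀ x : E3, ∀ i j : Fin 3,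
      Integrable
        (fun y : E3 => cKer Γ μ δ ‖x - y‖ *
          (cross3 (x - y) (ω y) i * (x - y) j + (x - y) i * cross3 (x - y) (ω y) j))
        volume ∧
      (fderiv ℝ (fun x' : E3 => biotSavart Γ μ δ ω x' j) x (e3 i) +
        fderiv ℝ (fun x' : E3 => biotSavart Γ μ δ ω x' i) x (e3 j)) / 2 =
        -(1 / (4 * π)) * ∫ y : E3, cKer Γ μ δ ‖x - y‖ *
          (cross3 (x - y) (ω y) i * (x - y) j + (x - y) i * cross3 (x - y) (ω y) j) := by
  intro x i j
  obtain ⟨hδ0, hδ1⟩ := hδ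
  have hK := locallyIntegrable_gradPhi hΓ hμ hδ0 (by linarith)
  have hK' := locallyIntegrable_gradPhiDeriv hΓ hμ hδ0 (by linarith)
  have hder := hasFDerivAt_convolution_of_differentiable_off_zero volume (by simp) crossFlipL hω
    hωsupp hK hK' (fun z hz => hasFDerivAt_gradPhi hμ hz) (continuousOn_gradPhiDeriv hμ) x
  have hex : Integrable (fun y => crossFlipL.precompR E3 (ω y) (gradPhiDeriv Γ μ δ (x - y))) :=
    hωsupp.convolutionExists_left (crossFlipL.precompR E3) hω hK' x
  let ev (i j : Fin 3) : (E3 →L[ℝ] E3) →L[ℝ] ℝ :=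
    (EuclideanSpace.proj j : E3 →L[ℝ] ℝ) ∘L ContinuousLinearMap.apply ℝ E3 (e3 i)
  have hev (i j : Fin 3) (y : E3) :
      ev i j (crossFlipL.precompR E3 (ω y) (gradPhiDeriv Γ μ δ (x - y))) =
        cross3 (gradPhiDeriv Γ μ δ (x - y) (e3 i)) (ω y) j := rfl
  have hint (i j : Fin 3) :
      Integrable fun y => cross3 (gradPhiDeriv Γ μ δ (x - y) (e3 i)) (ω y) j :=
    (ev i j).integrable_comp hex
  have hfd (i j : Fin 3) : fderiv ℝ (fun x' : E3 => biotSavart Γ μ δ ω x' j) x (e3 i) =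
      -(1 / (4 * π)) * ∫ y, cross3 (gradPhiDeriv Γ μ δ (x - y) (e3 i)) (ω y) j := by
    have h1 := (EuclideanSpace.proj j : E3 →L[ℝ] ℝ).hasFDerivAt.comp x
      (hder.const_smul (-(1 / (4 * π))))
    have h2 : HasFDerivAt (fun x' : E3 => biotSavart Γ μ δ ω x' j) _ x := h1
    rw [h2.fderiv, ← integral_congr_ae (ae_of_all _ (hev i j)), (ev i j).integral_comp_comm hex]
    rfl
  have hsum (y : E3) : cKer Γ μ δ ‖x - y‖ *
      (cross3 (x - y) (ω y) i * (x - y) j + (x - y) i * cross3 (x - y) (ω y) j) =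
      (cross3 (gradPhiDeriv Γ μ δ (x - y) (e3 i)) (ω y) j +
        cross3 (gradPhiDeriv Γ μ δ (x - y) (e3 j)) (ω y) i) / 2 := by
    rw [cross3_gradPhiDeriv_apply, cross3_gradPhiDeriv_apply]
    linear_combination -(gradProfile Γ μ δ ‖x - y‖ / 2) * cross3_e3_antisymm (ω y) i j
  simp_rw [hsum]
  refine ⟨((hint i j).add (hint j i)).div_const 2, ?_⟩
  rw [hfd, hfd, integral_div, integral_add (hint i j) (hint j i)]
  ring
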